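/- Let Q be a finite set of nodes, Σ a finite set of labels, and → ⊆ Q × Σ × Q a transition relation. For each σ ∈ Σ let A_σ : ℝⁿ → ℝⁿ and B_σ : ℝᵐ → ℝⁿ be linear maps and c_σ ∈ ℝⁿ, and for each q ∈ Q let P_q ⊆ ℝⁿ. Let E_σ be the orthogonal projection of ℝⁿ onto the orthogonal complement of the range of B_σ. Then a family of sets (C_q)_{q ∈ Q} with C_q ⊆ P_q for all q is controlled invariant for the hybrid control system with unconstrained inputs — i.e., for every transition (q, σ, q') ∈ → and every x ∈ C_q there exists u ∈ ℝᵐ with A_σ x + B_σ u + c_σ ∈ C_{q'} — if and only if for every transition (q, σ, q') ∈ → one has (E_σ ∘ A_σ) '' C_q + E_σ c_σ ⊆ E_σ '' C_{q'}, i.e., the family (C_q) is invariant for the hybrid algebraic system with data (E_σ A_σ, E_σ, E_σ c_σ). -/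

import Mathlib

open scoped Pointwise

/-- reduction of controlled invariance for a hybrid control system with
unconstrained inputs to invariance for a hybrid algebraic system with data
`(E_σ A_σ, E_σ, E_σ c_σ)`, where `E_σ` is the orthogonal projection onto `(range B_σ)ᗮ`. -/
theorem stmt2 (n m : ℕ) (Q Sig : Type*) [Fintype Q] [Fintype Sig]
    (T : Set (Q × Sig × Q))
    (A : Sig → EuclideanSpace ℝ (Fin n) →ₗ[ℝ] EuclideanSpace ℝ (Fin n))
    (B : Sig → EuclideanSpace ℝ (Fin m) →ₗ[ℝ] EuclideanSpace ℝ (Fin n))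
    (c : Sig → EuclideanSpace ℝ (Fin n))
    (P : Q → Set (EuclideanSpace ℝ (Fin n)))
    (E : Sig → EuclideanSpace ℝ (Fin n) →ₗ[ℝ] EuclideanSpace ℝ (Fin n))
    (hE : ∀ σ y, E σ y =
      (Submodule.orthogonalProjectionOnto (LinearMap.range (B σ))ᗮ y : EuclideanSpace ℝ (Fin n)))
    (C : Q → Set (EuclideanSpace ℝ (Fin n)))
    (hCP : ∀ q, C q ⊆ P q) :
    (∀ t ∈ T, ∀ x ∈ C t.1,
        ∃ u : EuclideanSpace ℝ (Fin m), A t.2.1 x + B t.2.1 u + c t.2.1 ∈ C t.2.2) ↔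
    (∀ t ∈ T,
        (fun x => E t.2.1 (A t.2.1 x)) '' C t.1 + {E t.2.1 (c t.2.1)}
          ⊆ E t.2.1 '' C t.2.2) := by
  have hker : ∀ σ y, E σ y = 0 ↔ ∃ u, B σ u = y := by
    intro σ y
    rw [hE, Submodule.coe_eq_zero, Submodule.orthogonalProjectionOnto_eq_zero_iff,
      Submodule.orthogonal_orthogonal, LinearMap.mem_range]
  refine forall₂_congr fun t _ => ?_
  obtain ⟨q, σ, q'⟩ := t
  simp only [Set.add_singleton, Set.image_image, Set.image_subset_iff]
  refine forall₂_congr fun x _ => ?_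
  simp only [Set.mem_preimage, Set.mem_image]
  constructor
  · rintro ⟨u, hu⟩
    refine ⟨_, hu, ?_⟩
    simp [(hker σ (B σ u)).2 ⟨u, rfl⟩]
  · rintro ⟨y, hy, hyE⟩
    obtain ⟨u, hu⟩ := (hker σ (y - (A σ x + c σ))).1 (by simp [hyE])
    refine ⟨u, ?_⟩
    have hsum : A σ x + B σ u + c σ = y := by rw [hu]; abel
    rwa [hsum]
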